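/- Let u(t,x) = a·exp(i(φ + (1/3)a²t))·exp(-|x|) with real constants a, φ. Then u is a weak-amplitude solution of the NLS-type peakon equation: writing u = A·e^{iΦ} with A = a·e^{-|x|} and Φ = φ + (1/3)a²t, the pair of weak-amplitude integral equations (the real and imaginary parts of the weak formulation obtained by integrating by parts to remove second derivatives of A) holds for all real test functions ψ₁, ψ₂ ∈ C_c^∞(ℝ²). In particular, among profiles u = a·exp(i(φ+ωt+kx))·e^{-|x-ct|} with a ≠ 0, the weak-amplitude equations force c = 0, k = 0, and ω = (1/3)a². -/

import Mathlib

open MeasureTheory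

noncomputable section

def psix (ψ : ℝ × ℝ → ℝ) (p : ℝ × ℝ) : ℝ := deriv (fun y => ψ (p.1, y)) p.2
def psixx (ψ : ℝ × ℝ → ℝ) (p : ℝ × ℝ) : ℝ := deriv (fun y => psix ψ (p.1, y)) p.2
def psit (ψ : ℝ × ℝ → ℝ) (p : ℝ × ℝ) : ℝ := deriv (fun s => ψ (s, p.2)) p.1

/-- Peakon amplitude A = a e^{-|x-ct|}. -/
def Apk (a c : ℝ) (p : ℝ × ℝ) : ℝ := a * Real.exp (-|p.2 - c * p.1|)

/-- a.e. x-derivative A_x = -a sgn(x-ct) e^{-|x-ct|}. -/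
def Apkx (a c : ℝ) (p : ℝ × ℝ) : ℝ :=
  -a * Real.sign (p.2 - c * p.1) * Real.exp (-|p.2 - c * p.1|)

/-- a.e. t-derivative A_t = a c sgn(x-ct) e^{-|x-ct|}. -/
def Apkt (a c : ℝ) (p : ℝ × ℝ) : ℝ :=
  a * c * Real.sign (p.2 - c * p.1) * Real.exp (-|p.2 - c * p.1|)

/-- Linear phase Φ = φ + ωt + kx. -/
def Phs (φ ω k : ℝ) (p : ℝ × ℝ) : ℝ := φ + ω * p.1 + k * p.2

/-- The density `χ'' (α e + β e³) + γ χ' e³ - χ (α e + δ e³)` with `e = exp (σ ξ)`. -/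
def expDensity (α β γ δ σ : ℝ) (χ : ℝ → ℝ) (ξ : ℝ) : ℝ :=
  deriv (deriv χ) ξ * (α * Real.exp (σ * ξ) + β * Real.exp (σ * ξ) ^ 3)
    + γ * deriv χ ξ * Real.exp (σ * ξ) ^ 3
    - χ ξ * (α * Real.exp (σ * ξ) + δ * Real.exp (σ * ξ) ^ 3)

/-- A primitive of `expDensity` up to a multiple of `χ e³`. -/
def expPrimitive (α β γ σ : ℝ) (χ : ℝ → ℝ) (ξ : ℝ) : ℝ :=
  deriv χ ξ * (α * Real.exp (σ * ξ) + β * Real.exp (σ * ξ) ^ 3)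
    + χ ξ * (-σ * α * Real.exp (σ * ξ) + (γ - 3 * σ * β) * Real.exp (σ * ξ) ^ 3)

section OneDimensional

variable {χ : ℝ → ℝ}

lemma contDiff_deriv_of_smooth (hχ : ContDiff ℝ (⊤ : ℕ∞) χ) :
    ContDiff ℝ (⊤ : ℕ∞) (deriv χ) :=
  (contDiff_infty_iff_deriv.1 hχ).2

lemma contDiff_expPrimitive (hχ : ContDiff ℝ (⊤ : ℕ∞) χ) (α β γ σ : ℝ) :
    ContDiff ℝ 1 (expPrimitive α β γ σ χ) := by
  have h0 : ContDiff ℝ 1 χ := hχ.of_le (by exact_mod_cast le_top)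
  have h1 : ContDiff ℝ 1 (deriv χ) :=
    (contDiff_deriv_of_smooth hχ).of_le (by exact_mod_cast le_top)
  unfold expPrimitive
  fun_prop

lemma hasCompactSupport_expPrimitive (h : HasCompactSupport χ) (α β γ σ : ℝ) :
    HasCompactSupport (expPrimitive α β γ σ χ) :=
  HasCompactSupport.add (h.deriv.mul_right) (h.mul_right)

lemma expDensity_eq (hχ : ContDiff ℝ (⊤ : ℕ∞) χ) (α β γ δ : ℝ) {σ : ℝ} (hσ : σ ^ 2 = 1)
    (ξ : ℝ) :
    expDensity α β γ δ σ χ ξ = deriv (expPrimitive α β γ σ χ) ξ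
      + (9 * β - 3 * σ * γ - δ) * (χ ξ * Real.exp (σ * ξ) ^ 3) := by
  have d0 : HasDerivAt χ (deriv χ ξ) ξ := (hχ.differentiable (by simp) ξ).hasDerivAt
  have d1 : HasDerivAt (deriv χ) (deriv (deriv χ) ξ) ξ :=
    ((contDiff_deriv_of_smooth hχ).differentiable (by simp) ξ).hasDerivAt
  have de : HasDerivAt (fun x => Real.exp (σ * x)) (Real.exp (σ * ξ) * (σ * 1)) ξ :=
    ((hasDerivAt_id ξ).const_mul σ).exp
  have de3 := de.pow 3
  have hW := (d1.mul ((de.const_mul α).add (de3.const_mul β))).add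
    (d0.mul ((de.const_mul (-σ * α)).add (de3.const_mul (γ - 3 * σ * β))))
  have hW' : deriv (expPrimitive α β γ σ χ) ξ = _ := hW.deriv
  rw [hW']
  simp only [expDensity, Pi.add_apply, Pi.pow_apply]
  linear_combination (χ ξ * (α * Real.exp (σ * ξ) + 9 * β * Real.exp (σ * ξ) ^ 3)) * hσ

lemma integrable_mul_exp (hχ : ContDiff ℝ (⊤ : ℕ∞) χ) (h : HasCompactSupport χ) (σ : ℝ) :
    Integrable (fun ξ => χ ξ * Real.exp (σ * ξ) ^ 3) := by
  have h0 := hχ.continuous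
  exact Continuous.integrable_of_hasCompactSupport (by fun_prop) h.mul_right

lemma integrable_deriv_expPrimitive (hχ : ContDiff ℝ (⊤ : ℕ∞) χ) (h : HasCompactSupport χ)
    (α β γ σ : ℝ) : Integrable (deriv (expPrimitive α β γ σ χ)) :=
  ((contDiff_expPrimitive hχ α β γ σ).continuous_deriv le_rfl).integrable_of_hasCompactSupport
    (hasCompactSupport_expPrimitive h α β γ σ).deriv

lemma integrable_expDensity (hχ : ContDiff ℝ (⊤ : ℕ∞) χ) (h : HasCompactSupport χ)
    (α β γ δ : ℝ) {σ : ℝ} (hσ : σ ^ 2 = 1) : Integrable (expDensity α β γ δ σ χ) := by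
  rw [funext (expDensity_eq hχ α β γ δ hσ)]
  exact (integrable_deriv_expPrimitive hχ h α β γ σ).add ((integrable_mul_exp hχ h σ).const_mul _)

/-- Integration by parts on both half-lines for a function which is an exponential density on
each of them. -/
lemma integral_of_eq_expDensity (hχ : ContDiff ℝ (⊤ : ℕ∞) χ) (h : HasCompactSupport χ)
    {f : ℝ → ℝ} {α β γ δ α' β' γ' δ' : ℝ}
    (hpos : ∀ ξ, 0 < ξ → f ξ = expDensity α β γ δ (-1) χ ξ)
    (hneg : ∀ ξ, ξ < 0 → f ξ = expDensity α' β' γ' δ' 1 χ ξ) :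
    ∫ ξ, f ξ = deriv χ 0 * (α' + β' - α - β)
      + χ 0 * (-α' + γ' - 3 * β' - α - γ - 3 * β)
      + (9 * β + 3 * γ - δ) * (∫ ξ in Set.Ioi 0, χ ξ * Real.exp (-1 * ξ) ^ 3)
      + (9 * β' - 3 * γ' - δ') * (∫ ξ in Set.Iic 0, χ ξ * Real.exp (1 * ξ) ^ 3) := by
  have hm : (-1 : ℝ) ^ 2 = 1 := by norm_num
  have hp : (1 : ℝ) ^ 2 = 1 := by norm_num
  have ip : IntegrableOn f (Set.Ioi 0) :=
    (integrable_expDensity hχ h α β γ δ hm).integrableOn.congr_fun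
      (fun ξ hξ => (hpos ξ hξ).symm) measurableSet_Ioi
  have im : IntegrableOn f (Set.Iio 0) :=
    (integrable_expDensity hχ h α' β' γ' δ' hp).integrableOn.congr_fun
      (fun ξ hξ => (hneg ξ hξ).symm) measurableSet_Iio
  rw [← intervalIntegral.integral_Iic_add_Ioi ((integrableOn_Iic_iff_integrableOn_Iio (by finiteness)).2 im) ip,
    integral_Iic_eq_integral_Iio, setIntegral_congr_fun measurableSet_Iio hneg,
    ← integral_Iic_eq_integral_Iio, setIntegral_congr_fun measurableSet_Ioi hpos]
  simp_rw [expDensity_eq hχ α β γ δ hm, expDensity_eq hχ α' β' γ' δ' hp]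
  rw [integral_add (integrable_deriv_expPrimitive hχ h _ _ _ _).integrableOn
      ((integrable_mul_exp hχ h _).const_mul _).integrableOn,
    integral_add (integrable_deriv_expPrimitive hχ h _ _ _ _).integrableOn
      ((integrable_mul_exp hχ h _).const_mul _).integrableOn,
    (hasCompactSupport_expPrimitive h _ _ _ _).integral_Iic_deriv_eq
      (contDiff_expPrimitive hχ _ _ _ _),
    (hasCompactSupport_expPrimitive h _ _ _ _).integral_Ioi_deriv_eq
      (contDiff_expPrimitive hχ _ _ _ _), integral_const_mul, integral_const_mul]
  simp only [expPrimitive, mul_zero, Real.exp_zero]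
  ring

end OneDimensional

section TravellingProducts

variable {η χ : ℝ → ℝ}

/-- The test function `η(t) χ(x - ct)`. -/
def travel (c : ℝ) (η χ : ℝ → ℝ) (p : ℝ × ℝ) : ℝ := η p.1 * χ (p.2 - c * p.1)

lemma psix_travel (c : ℝ) (η χ : ℝ → ℝ) : psix (travel c η χ) = travel c η (deriv χ) := by
  funext p
  simp only [psix, travel]
  rw [deriv_const_mul_field, deriv_comp_sub_const]

lemma psixx_travel (c : ℝ) (η χ : ℝ → ℝ) :
    psixx (travel c η χ) = travel c η (deriv (deriv χ)) := by
  rw [← psix_travel, ← psix_travel]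
  rfl

lemma contDiff_travel (c : ℝ) (hη : ContDiff ℝ (⊤ : ℕ∞) η) (hχ : ContDiff ℝ (⊤ : ℕ∞) χ) :
    ContDiff ℝ (⊤ : ℕ∞) (travel c η χ) := by
  unfold travel
  fun_prop

lemma hasCompactSupport_travel (c : ℝ) (hη : HasCompactSupport η) (hχ : HasCompactSupport χ) :
    HasCompactSupport (travel c η χ) := by
  refine HasCompactSupport.intro
    ((hη.isCompact.prod hχ.isCompact).image
      (show Continuous (fun q : ℝ × ℝ => (q.1, q.2 + c * q.1)) by fun_prop)) fun p hp => ?_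
  by_contra hne
  refine hp ⟨(p.1, p.2 - c * p.1), ⟨subset_tsupport _ ?_, subset_tsupport _ ?_⟩, by simp⟩
  · exact left_ne_zero_of_mul hne
  · exact right_ne_zero_of_mul hne

lemma integral_travel (c : ℝ) (η G : ℝ → ℝ) :
    ∫ p, travel c η G p = (∫ t, η t) * ∫ ξ, G ξ := by
  have hmp : MeasurePreserving (fun p : ℝ × ℝ => (p.1, p.2 - c * p.1)) volume volume := by
    refine (MeasurePreserving.id volume).skew_product
      (g := fun t x => x - c * t) (by fun_prop) (Filter.Eventually.of_forall fun t => ?_)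
    exact (measurePreserving_sub_right volume (c * t)).map_eq
  have hemb : MeasurableEmbedding (fun p : ℝ × ℝ => (p.1, p.2 - c * p.1)) := by
    refine Continuous.measurableEmbedding (by fun_prop) fun p q hpq => ?_
    simp only [Prod.mk.injEq] at hpq
    obtain ⟨h1, h2⟩ := hpq
    rw [h1] at h2
    exact Prod.ext h1 (by linarith)
  rw [← integral_prod_mul η G]
  exact hmp.integral_comp hemb (fun q => η q.1 * G q.2)

end TravellingProducts

lemma psix_Phs (φ ω k : ℝ) (p : ℝ × ℝ) : psix (Phs φ ω k) p = k := by
  simp [psix, Phs]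

lemma psixx_Phs (φ ω k : ℝ) (p : ℝ × ℝ) : psixx (Phs φ ω k) p = 0 := by
  simp [psixx, psix_Phs]

lemma psit_Phs (φ ω k : ℝ) (p : ℝ × ℝ) : psit (Phs φ ω k) p = ω := by
  simp [psit, Phs]

/-- The density of the first equation at constant wave number. -/
def firstDensity (a c k : ℝ) (χ : ℝ → ℝ) (ξ : ℝ) : ℝ :=
  deriv (deriv χ) ξ * (a * c * ξ.sign * Real.exp (-|ξ|)
      + k * (a * Real.exp (-|ξ|)) ^ 2 * (-a * ξ.sign * Real.exp (-|ξ|)))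
    + deriv χ ξ * (2 * k * (a * Real.exp (-|ξ|)) * (-a * ξ.sign * Real.exp (-|ξ|)) ^ 2)
    - χ ξ * (a * c * ξ.sign * Real.exp (-|ξ|)
      + (5 / 6) * k * (-a * ξ.sign * Real.exp (-|ξ|)) ^ 3
      + (1 / 2) * (5 + 7 * k ^ 2) * k * (a * Real.exp (-|ξ|)) ^ 2
        * (-a * ξ.sign * Real.exp (-|ξ|)))

/-- The density of the second equation at zero wave number. -/
def secondDensity (a ω : ℝ) (χ : ℝ → ℝ) (ξ : ℝ) : ℝ :=
  deriv (deriv χ) ξ * (a * Real.exp (-|ξ|) * ω)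
    - deriv χ ξ * ((1 / 6) * (-a * ξ.sign * Real.exp (-|ξ|)) ^ 3
      - (1 / 2) * (a * Real.exp (-|ξ|)) ^ 2 * (-a * ξ.sign * Real.exp (-|ξ|)))
    - χ ξ * (-(1 / 2) * (a * Real.exp (-|ξ|)) * (-a * ξ.sign * Real.exp (-|ξ|)) ^ 2
      - (1 / 2) * (a * Real.exp (-|ξ|)) ^ 3 + ω * (a * Real.exp (-|ξ|)))

lemma integral_firstDensity {χ : ℝ → ℝ} (hχ : ContDiff ℝ (⊤ : ℕ∞) χ)
    (h : HasCompactSupport χ) (a c k : ℝ) :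
    ∫ ξ, firstDensity a c k χ ξ = 2 * a * (k * a ^ 2 - c) * deriv χ 0
      + k * a ^ 3 * (1 / 3 + 7 / 2 * k ^ 2) *
        ((∫ ξ in Set.Ioi 0, χ ξ * Real.exp (-1 * ξ) ^ 3)
          - ∫ ξ in Set.Iic 0, χ ξ * Real.exp (1 * ξ) ^ 3) := by
  rw [integral_of_eq_expDensity hχ h (α := a * c) (β := -k * a ^ 3) (γ := 2 * k * a ^ 3)
    (δ := -k * a ^ 3 * (10 / 3 + 7 / 2 * k ^ 2)) (α' := -(a * c)) (β' := k * a ^ 3)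
    (γ' := 2 * k * a ^ 3) (δ' := k * a ^ 3 * (10 / 3 + 7 / 2 * k ^ 2))]
  · ring
  · intro ξ hξ
    rw [firstDensity, expDensity, Real.sign_of_pos hξ, abs_of_pos hξ, neg_one_mul]
    ring
  · intro ξ hξ
    rw [firstDensity, expDensity, Real.sign_of_neg hξ, abs_of_neg hξ, neg_neg, one_mul]
    ring

lemma integral_secondDensity {χ : ℝ → ℝ} (hχ : ContDiff ℝ (⊤ : ℕ∞) χ)
    (h : HasCompactSupport χ) (a ω : ℝ) :
    ∫ ξ, secondDensity a ω χ ξ = 2 * a * (a ^ 2 / 3 - ω) * χ 0 := by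
  rw [integral_of_eq_expDensity hχ h (α := ω * a) (β := 0) (γ := -a ^ 3 / 3)
    (δ := -a ^ 3) (α' := ω * a) (β' := 0) (γ' := a ^ 3 / 3) (δ' := -a ^ 3)]
  · ring
  · intro ξ hξ
    rw [secondDensity, expDensity, Real.sign_of_pos hξ, abs_of_pos hξ, neg_one_mul]
    ring
  · intro ξ hξ
    rw [secondDensity, expDensity, Real.sign_of_neg hξ, abs_of_neg hξ, neg_neg, one_mul]
    ring

/-- A nonnegative bump supported in `(1, 3)` separates the two half-lines. -/
lemma exists_bump_halfLine : ∃ χ : ℝ → ℝ, ContDiff ℝ (⊤ : ℕ∞) χ ∧ HasCompactSupport χ ∧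
    deriv χ 0 = 0 ∧ (∫ ξ in Set.Iic 0, χ ξ * Real.exp (1 * ξ) ^ 3) = 0 ∧
    0 < ∫ ξ in Set.Ioi 0, χ ξ * Real.exp (-1 * ξ) ^ 3 := by
  let b : ContDiffBump (2 : ℝ) := ⟨1 / 2, 1, by norm_num, by norm_num⟩
  have hz : ∀ ξ : ℝ, ξ < 1 → b ξ = 0 := fun ξ hξ => by
    refine b.zero_of_le_dist ?_
    rw [Real.dist_eq, abs_of_neg (by linarith)]
    change (1 : ℝ) ≤ _
    linarith
  refine ⟨b, b.contDiff, b.hasCompactSupport, ?_, ?_, ?_⟩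
  · have : (b : ℝ → ℝ) =ᶠ[nhds 0] fun _ => 0 := by
      filter_upwards [Iio_mem_nhds (zero_lt_one' ℝ)] with ξ hξ using hz ξ hξ
    rw [this.deriv_eq, deriv_const]
  · refine setIntegral_eq_zero_of_forall_eq_zero fun ξ hξ => ?_
    rw [hz ξ (lt_of_le_of_lt hξ zero_lt_one), zero_mul]
  · rw [setIntegral_eq_integral_of_forall_compl_eq_zero]
    · have hb := b.continuous
      refine Continuous.integral_pos_of_hasCompactSupport_nonneg_nonzero (x := 2) (by fun_prop)
        b.hasCompactSupport.mul_right
        (fun ξ => mul_nonneg b.nonneg (by positivity)) ?_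
      have : b 2 = 1 := b.one_of_mem_closedBall (by simp [b])
      rw [this]
      positivity
    · intro ξ hξ
      rw [hz ξ (lt_of_le_of_lt (not_lt.1 hξ) zero_lt_one), zero_mul]

theorem nls_peakon_breather (a c k ω φ : ℝ) (ha : a ≠ 0) :
    ((∀ ψ₁ : ℝ × ℝ → ℝ, ContDiff ℝ (⊤ : ℕ∞) ψ₁ → HasCompactSupport ψ₁ →
        (∫ p : ℝ × ℝ,
          (psixx ψ₁ p * (Apkt a c p + psix (Phs φ ω k) p * (Apk a c p)^2 * Apkx a c p)
           + psix ψ₁ p * (2 * psix (Phs φ ω k) p * Apk a c p * (Apkx a c p)^2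
               + psixx (Phs φ ω k) p * (Apk a c p)^2 * Apkx a c p)
           - ψ₁ p * (Apkt a c p + (5/6) * psix (Phs φ ω k) p * (Apkx a c p)^3
               + (1/2) * psixx (Phs φ ω k) p * Apk a c p * (Apkx a c p)^2
               + (1/2) * (5 + 7 * (psix (Phs φ ω k) p)^2) * psix (Phs φ ω k) p
                   * (Apk a c p)^2 * Apkx a c p
               + (1/2) * (1 + 7 * (psix (Phs φ ω k) p)^2) * psixx (Phs φ ω k) p
                   * (Apk a c p)^3))) = 0) ∧
     (∀ ψ₂ : ℝ × ℝ → ℝ, ContDiff ℝ (⊤ : ℕ∞) ψ₂ → HasCompactSupport ψ₂ →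
        (∫ p : ℝ × ℝ,
          (psixx ψ₂ p * (Apk a c p * psit (Phs φ ω k) p)
           - psix ψ₂ p * ((1/6) * (Apkx a c p)^3
               + (1/2) * (3 * (psix (Phs φ ω k) p)^2 - 1) * (Apk a c p)^2 * Apkx a c p
               + psix (Phs φ ω k) p * psixx (Phs φ ω k) p * (Apk a c p)^3)
           - ψ₂ p * ((1/2) * (3 * (psix (Phs φ ω k) p)^2 - 1) * Apk a c p * (Apkx a c p)^2
               + psix (Phs φ ω k) p * psixx (Phs φ ω k) p * (Apk a c p)^2 * Apkx a c p
               - (1/2) * (1 + (psix (Phs φ ω k) p)^2) * (1 - 3 * (psix (Phs φ ω k) p)^2)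
                   * (Apk a c p)^3
               + psit (Phs φ ω k) p * Apk a c p))) = 0))
    ↔ (c = 0 ∧ k = 0 ∧ ω = (1/3) * a^2) := by
  simp only [psix_Phs, psixx_Phs, psit_Phs]
  let b : ContDiffBump (0 : ℝ) := ⟨1, 2, by norm_num, by norm_num⟩
  have hb0 : b 0 = 1 := b.one_of_mem_closedBall (by simp [b])
  have hbpos : 0 < ∫ t, b t := b.integral_pos
  constructor
  · rintro ⟨h1, h2⟩
    have e1 : ∀ χ : ℝ → ℝ, ContDiff ℝ (⊤ : ℕ∞) χ → HasCompactSupport χ →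
        ∫ ξ, firstDensity a c k χ ξ = 0 := by
      intro χ hχ hs
      have key := h1 (travel c b χ) (contDiff_travel c b.contDiff hχ)
        (hasCompactSupport_travel c b.hasCompactSupport hs)
      rw [psix_travel, psixx_travel] at key
      refine (mul_eq_zero.1 ?_).resolve_left hbpos.ne'
      refine (integral_travel c b _).symm.trans (Eq.trans ?_ key)
      congr 1
      funext p
      simp only [travel, firstDensity, Apk, Apkx, Apkt]
      ring
    have hk : k = 0 := by
      obtain ⟨χ, hχ, hs, hd, hl, hr⟩ := exists_bump_halfLine
      have key := e1 χ hχ hs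
      rw [integral_firstDensity hχ hs, hd, hl, mul_zero, zero_add, sub_zero] at key
      have hpos : 0 < 1 / 3 + 7 / 2 * k ^ 2 := by positivity
      have hka :=
        (mul_eq_zero.1 ((mul_eq_zero.1 key).resolve_right hr.ne')).resolve_right hpos.ne'
      exact (mul_eq_zero.1 hka).resolve_right (pow_ne_zero 3 ha)
    subst hk
    have hc : c = 0 := by
      have hχ : ContDiff ℝ (⊤ : ℕ∞) (fun ξ : ℝ => ξ * b ξ) := contDiff_id.mul b.contDiff
      have hs : HasCompactSupport (fun ξ : ℝ => ξ * b ξ) := b.hasCompactSupport.mul_left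
      have key := e1 _ hχ hs
      have hd : deriv (fun ξ : ℝ => ξ * b ξ) 0 = 1 := by
        have hbd : HasDerivAt b (deriv b 0) 0 :=
          ((b.contDiff (n := 1)).differentiable (by simp) 0).hasDerivAt
        have := ((hasDerivAt_id' (0 : ℝ)).fun_mul hbd).deriv
        simpa [hb0] using this
      rw [integral_firstDensity hχ hs, hd] at key
      simpa [ha] using key
    subst hc
    refine ⟨rfl, rfl, ?_⟩
    have key := h2 (travel 0 b b) (contDiff_travel 0 b.contDiff b.contDiff)
        (hasCompactSupport_travel 0 b.hasCompactSupport b.hasCompactSupport)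
    rw [psix_travel, psixx_travel] at key
    have e2 : ∫ ξ, secondDensity a ω b ξ = 0 := by
      refine (mul_eq_zero.1 ?_).resolve_left hbpos.ne'
      refine (integral_travel 0 b _).symm.trans (Eq.trans ?_ key)
      congr 1
      funext p
      simp only [travel, secondDensity, Apk, Apkx]
      ring
    rw [integral_secondDensity b.contDiff b.hasCompactSupport, hb0, mul_one] at e2
    have := (mul_eq_zero.1 e2).resolve_left (by positivity)
    linarith
  · rintro ⟨rfl, rfl, rfl⟩
    refine ⟨fun ψ _ _ => by simp [Apkt], fun ψ hψ hs => ?_⟩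
    trans ∫ p : ℝ × ℝ, secondDensity a (1 / 3 * a ^ 2) (fun y => ψ (p.1, y)) p.2
    · congr 1
      funext p
      simp only [psixx, psix, secondDensity, Apk, Apkx, zero_mul, sub_zero]
      ring
    by_cases hint : Integrable (fun p : ℝ × ℝ => secondDensity a (1 / 3 * a ^ 2)
        (fun y => ψ (p.1, y)) p.2)
    · rw [Measure.volume_eq_prod, integral_prod _ hint]
      refine integral_eq_zero_of_ae (Filter.Eventually.of_forall fun t => ?_)
      have hχ : ContDiff ℝ (⊤ : ℕ∞) (fun y => ψ (t, y)) := by fun_prop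
      have hc : HasCompactSupport (fun y => ψ (t, y)) :=
        HasCompactSupport.intro (hs.isCompact.image continuous_snd) fun y hy => by
          by_contra hne
          exact hy ⟨(t, y), subset_tsupport _ hne, rfl⟩
      refine (integral_secondDensity hχ hc _ _).trans ?_
      simp only [Pi.zero_apply]
      ring
    · exact integral_undef hint
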